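/- arXiv:2501.00567 — 2 statements merged into one kernel-verified Lean document; each statement's English description precedes it below -/
import Mathlib

section
/- For every finite triangle-free simple graph G there exists a probability distribution p on the independent sets of G such that every vertex v of G is covered with probability at least f(d_G(v)), where d_G(v) is the degree of v in G. -/
open Finset

/-- The Shearer function: `f x = ((1-x) + x·ln x)/(x-1)²` for `x ∈ (0,∞)\{1}`,
`f 1 = 1/2`, and `f x = 1` for `x ≤ 0`. -/
noncomputable def shearerF (x : ℝ) : ℝ :=
  if x ≤ 0 then 1
  else if x = 1 then 1 / 2
  else ((1 - x) + x * Real.log x) / (x - 1) ^ 2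

/-- `I` is an independent set of `G`: no two of its vertices are adjacent. -/
def IsIndepFinset {V : Type*} (G : SimpleGraph V) (I : Finset V) : Prop :=
  ∀ u ∈ I, ∀ v ∈ I, ¬ G.Adj u v

theorem sh_alg1 (a : ℝ) {z z' : ℝ} (hz : z ≠ 0) (hz' : z' ≠ 0) :
    a / z' - (a / z - a / z ^ 2 * (z' - z)) = a * (z' - z) ^ 2 / (z ^ 2 * z') := by
  field_simp
  ring

theorem sh_alg2 {a b : ℝ} (hz : a + b ≠ 0) :
    1 - (a / (a + b) + a / (a + b) ^ 2 * b) = b ^ 2 / (a + b) ^ 2 := by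
  field_simp
  ring

theorem sh_zpos {x t : ℝ} (hx : 0 < x) (h0 : 0 ≤ t) (h1 : t ≤ 1) : 0 < 1 - t + x * t := by
  rcases eq_or_lt_of_le h0 with rfl | h
  · norm_num
  · have := mul_pos hx h
    linarith

noncomputable def shK (x : ℝ) : ℝ := ∫ t in (0:ℝ)..1, t * (1 - t) / (1 - t + x * t) ^ 2

theorem sh_int1 {x : ℝ} (hx : 0 < x) :
    IntervalIntegrable (fun t : ℝ => (1 - t) / (1 - t + x * t)) MeasureTheory.volume 0 1 := by
  apply ContinuousOn.intervalIntegrable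
  rw [Set.uIcc_of_le zero_le_one]
  apply ContinuousOn.div (by fun_prop) (by fun_prop)
  intro t ht
  exact (sh_zpos hx ht.1 ht.2).ne'

theorem sh_int2 {x : ℝ} (hx : 0 < x) :
    IntervalIntegrable (fun t : ℝ => t * (1 - t) / (1 - t + x * t) ^ 2)
      MeasureTheory.volume 0 1 := by
  apply ContinuousOn.intervalIntegrable
  rw [Set.uIcc_of_le zero_le_one]
  apply ContinuousOn.div (by fun_prop) (by fun_prop)
  intro t ht
  exact (pow_pos (sh_zpos hx ht.1 ht.2) 2).ne'

theorem sh_eq {x : ℝ} (hx : 0 < x) :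
    shearerF x = ∫ t in (0:ℝ)..1, (1 - t) / (1 - t + x * t) := by
  unfold shearerF
  rw [if_neg (not_le.mpr hx)]
  split_ifs with h
  · subst h
    have : ∀ t : ℝ, (1 - t) / (1 - t + 1 * t) = 1 - t := by intro t; simp
    simp_rw [this]
    rw [intervalIntegral.integral_sub (by simp) (by simp)]
    simp
    norm_num
  · have hc : x - 1 ≠ 0 := sub_ne_zero.mpr h
    have key : ∀ t ∈ Set.uIcc (0:ℝ) 1,
        HasDerivAt (fun t : ℝ => - t / (x - 1) + x / (x - 1) ^ 2 * Real.log (1 - t + x * t))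
          ((1 - t) / (1 - t + x * t)) t := by
      intro t ht
      rw [Set.uIcc_of_le zero_le_one] at ht
      have hz := (sh_zpos hx ht.1 ht.2).ne'
      have h1 : HasDerivAt (fun t : ℝ => 1 - t + x * t) (-1 + x * 1) t :=
        ((hasDerivAt_id t).const_sub 1).add ((hasDerivAt_id t).const_mul x)
      have h2 := ((hasDerivAt_id t).neg.div_const (x - 1)).add
        ((h1.log hz).const_mul (x / (x - 1) ^ 2))
      refine h2.congr_deriv ?_
      field_simp
      ring
    rw [intervalIntegral.integral_eq_sub_of_hasDerivAt key (sh_int1 hx)]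
    simp
    field_simp
    ring

theorem sh_ode {x : ℝ} (hx : 0 < x) :
    1 - (1 + x) * shearerF x + shK x * (x * (x - 1)) = 0 := by
  have key : ∀ t ∈ Set.uIcc (0:ℝ) 1,
      HasDerivAt (fun t : ℝ => - x * (t * (1 - t) / (1 - t + x * t)))
        (1 - (1 + x) * ((1 - t) / (1 - t + x * t))
          + (x * (x - 1)) * (t * (1 - t) / (1 - t + x * t) ^ 2)) t := by
    intro t ht
    rw [Set.uIcc_of_le zero_le_one] at ht
    have hz := (sh_zpos hx ht.1 ht.2).ne'
    have h1 : HasDerivAt (fun t : ℝ => 1 - t + x * t) (-1 + x * 1) t :=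
      ((hasDerivAt_id t).const_sub 1).add ((hasDerivAt_id t).const_mul x)
    have h2 := ((((hasDerivAt_id t).mul ((hasDerivAt_id t).const_sub 1)).div h1 hz).const_mul (-x))
    refine h2.congr_deriv ?_
    simp only [id, Pi.mul_apply]
    field_simp
    ring
  have hi1 := (sh_int1 hx).const_mul (1 + x)
  have hi2 := (sh_int2 hx).const_mul (x * (x - 1))
  have hi0 : IntervalIntegrable (fun _ : ℝ => (1:ℝ)) MeasureTheory.volume 0 1 := by simp
  have := intervalIntegral.integral_eq_sub_of_hasDerivAt key ((hi0.sub hi1).add hi2)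
  rw [intervalIntegral.integral_add (hi0.sub hi1) hi2, intervalIntegral.integral_sub hi0 hi1,
    intervalIntegral.integral_const_mul, intervalIntegral.integral_const_mul, ← sh_eq hx] at this
  simp at this
  unfold shK
  linarith

theorem sh_tangent_pos {x y : ℝ} (hx : 0 < x) (hy : 0 < y) :
    shearerF x + shK x * (x - y) ≤ shearerF y := by
  rw [sh_eq hx, sh_eq hy, shK, ← intervalIntegral.integral_mul_const,
    ← intervalIntegral.integral_add (sh_int1 hx) ((sh_int2 hx).mul_const _)]
  apply intervalIntegral.integral_mono_on zero_le_one
    ((sh_int1 hx).add ((sh_int2 hx).mul_const _)) (sh_int1 hy)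
  intro t ht
  have hz := sh_zpos hx ht.1 ht.2
  have hzn := hz.ne'
  have hz' := sh_zpos hy ht.1 ht.2
  have hzn' := hz'.ne'
  have h1 : 0 ≤ 1 - t := by linarith [ht.2]
  have : (1 - t) / (1 - t + y * t) - ((1 - t) / (1 - t + x * t)
      + t * (1 - t) / (1 - t + x * t) ^ 2 * (x - y))
      = (1 - t) * (t * (y - x)) ^ 2 / ((1 - t + x * t) ^ 2 * (1 - t + y * t)) := by
    have h := sh_alg1 (1 - t) hzn hzn'
    rw [show (1 - t + y * t) - (1 - t + x * t) = t * (y - x) by ring] at h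
    rw [← h]
    ring
  have h2 : 0 ≤ (1 - t) * (t * (y - x)) ^ 2 / ((1 - t + x * t) ^ 2 * (1 - t + y * t)) := by
    positivity
  linarith

theorem sh_tangent_zero {x : ℝ} (hx : 0 < x) :
    shearerF x + shK x * x ≤ 1 := by
  rw [sh_eq hx, shK, ← intervalIntegral.integral_mul_const,
    ← intervalIntegral.integral_add (sh_int1 hx) ((sh_int2 hx).mul_const _)]
  have : (1:ℝ) = ∫ t in (0:ℝ)..1, (1:ℝ) := by simp
  conv_rhs => rw [this]
  apply intervalIntegral.integral_mono_on zero_le_one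
    ((sh_int1 hx).add ((sh_int2 hx).mul_const _)) (by simp)
  intro t ht
  have hz := sh_zpos hx ht.1 ht.2
  have hzn := hz.ne'
  have : 1 - ((1 - t) / (1 - t + x * t)
      + t * (1 - t) / (1 - t + x * t) ^ 2 * x)
      = (x * t) ^ 2 / ((1 - t + x * t) ^ 2) := by
    rw [← sh_alg2 hzn]
    ring
  have h2 : 0 ≤ (x * t) ^ 2 / ((1 - t + x * t) ^ 2) := by
    positivity
  linarith

theorem sh_zero : shearerF 0 = 1 := by simp [shearerF]

theorem sh_tangent {x y : ℝ} (hx : 0 < x) (hy : 0 ≤ y) :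
    shearerF x + shK x * (x - y) ≤ shearerF y := by
  rcases eq_or_lt_of_le hy with rfl | h
  · rw [sh_zero, sub_zero]; exact sh_tangent_zero hx
  · exact sh_tangent_pos hx h

theorem sh_K_nonneg (x : ℝ) : 0 ≤ shK x := by
  apply intervalIntegral.integral_nonneg zero_le_one
  intro t ht
  have h1 : 0 ≤ 1 - t := by linarith [ht.2]
  have := ht.1
  positivity

theorem sh_le_one {x : ℝ} (hx : 0 ≤ x) : shearerF x ≤ 1 := by
  rcases eq_or_lt_of_le hx with rfl | h
  · rw [sh_zero]
  · have := sh_tangent_zero h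
    have := mul_nonneg (sh_K_nonneg x) hx
    linarith

theorem sh_upper {x y m : ℝ} (hm : 0 < m) (hm1 : m ≤ 1) (hx : m ≤ x) (hy : m ≤ y) :
    shearerF y ≤ shearerF x + shK x * (x - y) + (y - x) ^ 2 / m ^ 3 := by
  have hx0 := hm.trans_le hx
  have hy0 := hm.trans_le hy
  have hc : (y - x) ^ 2 / m ^ 3 = ∫ t in (0:ℝ)..1, (y - x) ^ 2 / m ^ 3 := by simp
  rw [hc, sh_eq hx0, sh_eq hy0, shK, ← intervalIntegral.integral_mul_const,
    ← intervalIntegral.integral_add (sh_int1 hx0) ((sh_int2 hx0).mul_const _),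
    ← intervalIntegral.integral_add ((sh_int1 hx0).add ((sh_int2 hx0).mul_const _)) (by simp)]
  apply intervalIntegral.integral_mono_on zero_le_one (sh_int1 hy0)
    (((sh_int1 hx0).add ((sh_int2 hx0).mul_const _)).add (by simp))
  intro t ht
  have hz := sh_zpos hx0 ht.1 ht.2
  have hzn := hz.ne'
  have hz' := sh_zpos hy0 ht.1 ht.2
  have hzn' := hz'.ne'
  have ht0 := ht.1
  have h1 : 0 ≤ 1 - t := by linarith [ht.2]
  have : (1 - t) / (1 - t + y * t) - ((1 - t) / (1 - t + x * t)
      + t * (1 - t) / (1 - t + x * t) ^ 2 * (x - y))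
      = (1 - t) * (t * (y - x)) ^ 2 / ((1 - t + x * t) ^ 2 * (1 - t + y * t)) := by
    have h := sh_alg1 (1 - t) hzn hzn'
    rw [show (1 - t + y * t) - (1 - t + x * t) = t * (y - x) by ring] at h
    rw [← h]
    ring
  have hzm : m ≤ 1 - t + x * t := by nlinarith [mul_le_mul_of_nonneg_right hx ht0]
  have hzm' : m ≤ 1 - t + y * t := by nlinarith [mul_le_mul_of_nonneg_right hy ht0]
  have h2 : (1 - t) * (t * (y - x)) ^ 2 / ((1 - t + x * t) ^ 2 * (1 - t + y * t))
      ≤ (y - x) ^ 2 / m ^ 3 := by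
    apply div_le_div₀ (sq_nonneg _) _ (by positivity)
    · calc m ^ 3 = m ^ 2 * m := by ring
        _ ≤ _ := by gcongr
    · have ht2 : t ^ 2 ≤ 1 := by nlinarith [ht.2]
      have : (1 - t) * t ^ 2 ≤ 1 := by nlinarith [sq_nonneg t]
      calc (1 - t) * (t * (y - x)) ^ 2 = ((1 - t) * t ^ 2) * (y - x) ^ 2 := by ring
        _ ≤ 1 * (y - x) ^ 2 := by gcongr
        _ = _ := one_mul _
  linarith

theorem sh_deriv {x : ℝ} (hx : 0 < x) : HasDerivAt shearerF (-shK x) x := by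
  set m := min (x / 2) 1 with hm
  have hm0 : 0 < m := by rw [hm]; positivity
  have hmx : m ≤ x / 2 := min_le_left _ _
  rw [hasDerivAt_iff_isLittleO]
  have hO : (fun y => shearerF y - shearerF x - (y - x) • (-shK x))
      =O[nhds x] (fun y => (y - x) ^ 2) := by
    apply Asymptotics.IsBigO.of_bound (1 / m ^ 3)
    have : ∀ᶠ y in nhds x, x / 2 < y := lt_mem_nhds (by linarith)
    filter_upwards [this] with y hy
    have h1 := sh_tangent hx (by linarith : 0 ≤ y)
    have h2 := sh_upper hm0 (min_le_right _ _) (show m ≤ x by linarith) (hmx.trans hy.le)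
    rw [Real.norm_eq_abs, Real.norm_eq_abs, abs_of_nonneg (sq_nonneg (y - x)), smul_eq_mul,
      abs_of_nonneg (by linarith)]
    have : (y - x) ^ 2 / m ^ 3 = 1 / m ^ 3 * (y - x) ^ 2 := by ring
    linarith
  refine hO.trans_isLittleO ?_
  have h := (Asymptotics.isLittleO_pow_id (𝕜 := ℝ) one_lt_two).comp_tendsto
    (show Filter.Tendsto (fun y => y - x) (nhds x) (nhds 0) by
      have : Continuous fun y : ℝ => y - x := by fun_prop
      simpa using this.tendsto x)
  exact h

theorem sh_tangent' {x y : ℝ} (hy : 0 ≤ y) (hyx : y ≤ x) :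
    shearerF x + shK x * (x - y) ≤ shearerF y := by
  rcases eq_or_lt_of_le (hy.trans hyx) with h | h
  · have : y = x := le_antisymm hyx (h ▸ hy)
    rw [this]; simp
  · exact sh_tangent h hy

theorem sh_ode' {x : ℝ} (hx : 0 ≤ x) :
    1 - (1 + x) * shearerF x + shK x * (x * (x - 1)) = 0 := by
  rcases eq_or_lt_of_le hx with rfl | h
  · rw [sh_zero]; simp
  · exact sh_ode h

section graph

set_option linter.unusedSectionVars false

variable {V : Type*} [Fintype V] [DecidableEq V] (G : SimpleGraph V) [DecidableRel G.Adj]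

noncomputable def shD (y : V → ℝ) (S : Finset V) (u : V) : ℝ :=
  ∑ z ∈ S with G.Adj u z, Real.exp (y z - y u)

noncomputable def shPsi (w y : V → ℝ) (S : Finset V) : ℝ :=
  ∑ u ∈ S, w u * shearerF (shD G y S u)

noncomputable def shg (y : V → ℝ) (S : Finset V) (u : V) : ℝ :=
  ∑ z ∈ S with G.Adj u z, Real.exp (y z)

def shDel (S : Finset V) (v : V) : Finset V := S.filter (fun z => z ≠ v ∧ ¬ G.Adj v z)

theorem shD_nonneg (y : V → ℝ) (S : Finset V) (u : V) : 0 ≤ shD G y S u :=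
  Finset.sum_nonneg fun _ _ => (Real.exp_pos _).le

theorem shg_eq (y : V → ℝ) (S : Finset V) (u : V) :
    shg G y S u = shD G y S u * Real.exp (y u) := by
  unfold shg shD
  rw [Finset.sum_mul]
  refine Finset.sum_congr rfl fun z _ => ?_
  rw [← Real.exp_add]; congr 1; ring

theorem shD_cases (S : Finset V) (u : V) :
    (∀ y : V → ℝ, 0 < shD G y S u) ∨ (S.filter (G.Adj u) = ∅) := by
  rcases Finset.eq_empty_or_nonempty (S.filter (G.Adj u)) with h | h
  · exact Or.inr h
  · exact Or.inl fun y => Finset.sum_pos (fun _ _ => Real.exp_pos _) h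

theorem shD_empty {S : Finset V} {u : V} (h : S.filter (G.Adj u) = ∅) (y : V → ℝ) :
    shD G y S u = 0 := by
  unfold shD; rw [h]; simp

theorem shF_cont (S : Finset V) (u : V) :
    Continuous fun y : V → ℝ => shearerF (shD G y S u) := by
  rcases shD_cases G S u with h | h
  · have hc : Continuous fun y : V → ℝ => shD G y S u := by
      unfold shD; fun_prop
    rw [continuous_iff_continuousAt]
    intro y
    exact ContinuousAt.comp (f := fun y : V → ℝ => shD G y S u) (sh_deriv (h y)).continuousAt
      hc.continuousAt
  · simp_rw [shD_empty G h]
    exact continuous_const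

theorem shF_deriv (y g : V → ℝ) (S : Finset V) (u : V) :
    HasDerivAt (fun τ : ℝ => shearerF (shD G (y + τ • g) S u))
      (- shK (shD G y S u) * ∑ z ∈ S with G.Adj u z, Real.exp (y z - y u) * (g z - g u)) 0 := by
  rcases shD_cases G S u with h | h
  · have h1 : HasDerivAt (fun τ : ℝ => shD G (y + τ • g) S u)
        (∑ z ∈ S with G.Adj u z, Real.exp (y z - y u) * (g z - g u)) 0 := by
      unfold shD
      apply HasDerivAt.fun_sum
      intro z _
      have h2 : HasDerivAt (fun τ : ℝ => (y + τ • g) z - (y + τ • g) u) (g z - g u) 0 := by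
        have h3 := (((hasDerivAt_id (0:ℝ)).mul_const (g z)).const_add (y z)).fun_sub
          (((hasDerivAt_id (0:ℝ)).mul_const (g u)).const_add (y u))
        simpa using h3
      simpa using h2.exp
    have h0 : shD G (y + (0:ℝ) • g) S u = shD G y S u := by simp
    have h4 := sh_deriv (h y)
    rw [← h0] at h4 ⊢
    exact HasDerivAt.comp (h₂ := shearerF) (0:ℝ) h4 h1
  · simp_rw [shD_empty G h]
    rw [h]
    simpa using hasDerivAt_const (0:ℝ) (shearerF 0)

theorem shD_del (y : V → ℝ) (S : Finset V) {u v : V} (hn : ¬ G.Adj v u) :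
    shD G y S u - shD G y (shDel G S v) u
      = ∑ z ∈ S with G.Adj u z, if G.Adj v z then Real.exp (y z - y u) else 0 := by
  unfold shD shDel
  rw [Finset.filter_filter, Finset.sum_filter, Finset.sum_filter, Finset.sum_filter,
    ← Finset.sum_sub_distrib]
  refine Finset.sum_congr rfl fun z _ => ?_
  by_cases h1 : G.Adj u z
  · have hzv : z ≠ v := by
      rintro rfl
      exact hn h1.symm
    by_cases h2 : G.Adj v z <;> simp [h1, h2, hzv]
  · simp [h1]

/-- Pointwise lower bound. -/
theorem sh_point (hG : G.CliqueFree 3) (y : V → ℝ) (S : Finset V) (u v : V) :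
    (if u = v then 1 - shearerF (shD G y S u) - shK (shD G y S u) * shD G y S u else 0)
      - (if G.Adj u v then shearerF (shD G y S u) else 0)
      + shK (shD G y S u) *
        ∑ z ∈ S with G.Adj u z, (if G.Adj v z then Real.exp (y z - y u) else 0)
    ≤ (if u = v then 1 else 0) +
      (if u ≠ v ∧ ¬ G.Adj v u then shearerF (shD G y (shDel G S v) u) else 0)
      - shearerF (shD G y S u) := by
  by_cases huv : u = v
  · subst huv
    have : ∑ z ∈ S with G.Adj u z, (if G.Adj u z then Real.exp (y z - y u) else 0)
        = shD G y S u := by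
      unfold shD
      refine Finset.sum_congr rfl fun z hz => ?_
      rw [if_pos (Finset.mem_filter.mp hz).2]
    rw [this]
    simp
  · by_cases ha : G.Adj u v
    · have : ∑ z ∈ S with G.Adj u z, (if G.Adj v z then Real.exp (y z - y u) else 0) = 0 := by
        refine Finset.sum_eq_zero fun z hz => ?_
        rw [if_neg]
        intro hvz
        exact hG {u, v, z} (SimpleGraph.is3Clique_triple_iff.mpr
          ⟨ha, (Finset.mem_filter.mp hz).2, hvz⟩)
      rw [this]
      simp [huv, ha, ha.symm]
    · have hn : ¬ G.Adj v u := fun h => ha h.symm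
      have hd := shD_del G y S hn
      rw [← hd]
      have hle : shD G y (shDel G S v) u ≤ shD G y S u := by
        have : 0 ≤ shD G y S u - shD G y (shDel G S v) u := by
          rw [hd]
          refine Finset.sum_nonneg fun z _ => ?_
          split_ifs
          · exact (Real.exp_pos _).le
          · exact le_rfl
        linarith
      have := sh_tangent' (shD_nonneg G y (shDel G S v) u) hle
      simp only [huv, ha, hn, if_false, ne_eq, not_false_eq_true, and_self, if_true]
      linarith

theorem sh_coef (hG : G.CliqueFree 3) (y : V → ℝ) (S : Finset V) {u : V} (hu : u ∈ S) :
    shK (shD G y S u) * ∑ z ∈ S with G.Adj u z,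
        Real.exp (y z - y u) * (shg G y S z - shg G y S u)
    ≤ ∑ v ∈ S, Real.exp (y v) * ((if u = v then 1 else 0) +
      (if u ≠ v ∧ ¬ G.Adj v u then shearerF (shD G y (shDel G S v) u) else 0)
      - shearerF (shD G y S u)) := by
  have h1 := Finset.sum_le_sum (s := S) fun v _ =>
    mul_le_mul_of_nonneg_left (sh_point G hG y S u v) (Real.exp_pos (y v)).le
  refine le_trans (le_of_eq ?_) h1
  simp only [mul_add, mul_sub, Finset.sum_add_distrib, Finset.sum_sub_distrib]
  have e1 : ∑ v ∈ S, Real.exp (y v) * (if u = v then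
      1 - shearerF (shD G y S u) - shK (shD G y S u) * shD G y S u else 0)
      = Real.exp (y u) * (1 - shearerF (shD G y S u) - shK (shD G y S u) * shD G y S u) := by
    simp [hu]
  have e2 : ∑ v ∈ S, Real.exp (y v) * (if G.Adj u v then shearerF (shD G y S u) else 0)
      = shg G y S u * shearerF (shD G y S u) := by
    unfold shg
    rw [Finset.sum_mul, Finset.sum_filter]
    refine Finset.sum_congr rfl fun v _ => ?_
    split_ifs <;> simp
  have e3 : ∑ v ∈ S, Real.exp (y v) * (shK (shD G y S u) *
        ∑ z ∈ S with G.Adj u z, (if G.Adj v z then Real.exp (y z - y u) else 0))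
      = shK (shD G y S u) * ∑ z ∈ S with G.Adj u z, Real.exp (y z - y u) * shg G y S z := by
    simp only [Finset.mul_sum]
    rw [Finset.sum_comm]
    refine Finset.sum_congr rfl fun z _ => ?_
    unfold shg
    rw [Finset.sum_filter, Finset.mul_sum, Finset.mul_sum]
    refine Finset.sum_congr rfl fun v _ => ?_
    simp only [G.adj_comm z v]
    split_ifs
    · ring
    · simp
  have e4 : ∑ z ∈ S with G.Adj u z, Real.exp (y z - y u) * shg G y S u
      = shD G y S u * shg G y S u := by
    rw [← Finset.sum_mul]; rfl
  rw [e1, e2, e3, e4, shg_eq G y S u]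
  have := sh_ode' (shD_nonneg G y S u)
  linear_combination (- Real.exp (y u)) * this

theorem sh_total (hG : G.CliqueFree 3) (w : V → ℝ) (hw : ∀ v, 0 ≤ w v) (y : V → ℝ)
    (S : Finset V) :
    ∑ u ∈ S, w u * (shK (shD G y S u) * ∑ z ∈ S with G.Adj u z,
        Real.exp (y z - y u) * (shg G y S z - shg G y S u))
    ≤ ∑ v ∈ S, Real.exp (y v) * (w v + shPsi G w y (shDel G S v) - shPsi G w y S) := by
  have h1 := Finset.sum_le_sum (s := S) fun u hu =>
    mul_le_mul_of_nonneg_left (sh_coef G hG y S hu) (hw u)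
  refine h1.trans (le_of_eq ?_)
  simp only [Finset.mul_sum]
  rw [Finset.sum_comm]
  refine Finset.sum_congr rfl fun v hv => ?_
  have e1 : w v = ∑ u ∈ S, w u * (if u = v then 1 else 0) := by simp [hv]
  have e2 : shPsi G w y (shDel G S v) = ∑ u ∈ S, w u *
      (if u ≠ v ∧ ¬ G.Adj v u then shearerF (shD G y (shDel G S v) u) else 0) := by
    conv_lhs => unfold shPsi
    conv_lhs => enter [1]; unfold shDel
    rw [Finset.sum_filter]
    refine Finset.sum_congr rfl fun u _ => ?_
    split_ifs <;> simp
  rw [e1, e2, shPsi, ← Finset.sum_add_distrib, ← Finset.sum_sub_distrib, Finset.mul_sum]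
  refine Finset.sum_congr rfl fun u _ => ?_
  ring

theorem sh_max (w : V → ℝ) (hw : ∀ v, 0 ≤ w v) (S : Finset V) {ε : ℝ} (hε : 0 < ε) :
    ∃ y : V → ℝ, ∀ y', shPsi G w y' S - ε * ‖y'‖ ≤ shPsi G w y S - ε * ‖y‖ := by
  have hc : Continuous fun y : V → ℝ => shPsi G w y S - ε * ‖y‖ := by
    refine Continuous.sub ?_ (by fun_prop)
    unfold shPsi
    exact continuous_finsetSum _ fun u _ => continuous_const.mul (shF_cont G S u)
  have hb : ∀ y : V → ℝ, shPsi G w y S ≤ ∑ u ∈ S, w u := by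
    intro y
    refine Finset.sum_le_sum fun u _ => ?_
    have := mul_le_mul_of_nonneg_left (sh_le_one (shD_nonneg G y S u)) (hw u)
    linarith
  apply hc.exists_forall_ge
  have h1 : Filter.Tendsto (fun y : V → ℝ => (∑ u ∈ S, w u) - ε * ‖y‖)
      (Filter.cocompact _) Filter.atBot := by
    have := (tendsto_norm_cocompact_atTop (E := V → ℝ)).const_mul_atTop hε
    have := (Filter.tendsto_neg_atTop_atBot.comp this)
    have := Filter.tendsto_atBot_add_const_left _ (∑ u ∈ S, w u) this
    simpa [sub_eq_add_neg, Function.comp_def] using this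
  refine Filter.tendsto_atBot_mono (fun y => ?_) h1
  linarith [hb y]

theorem sh_dir (w : V → ℝ) (S : Finset V) {ε : ℝ} (hε : 0 < ε) {y : V → ℝ}
    (hy : ∀ y', shPsi G w y' S - ε * ‖y'‖ ≤ shPsi G w y S - ε * ‖y‖) (g : V → ℝ) :
    -(ε * ‖g‖) ≤ ∑ u ∈ S, w u * (shK (shD G y S u) * ∑ z ∈ S with G.Adj u z,
        Real.exp (y z - y u) * (g z - g u)) := by
  have hd : HasDerivAt (fun τ : ℝ => shPsi G w (y + τ • g) S)
      (∑ u ∈ S, w u * (- shK (shD G y S u) * ∑ z ∈ S with G.Adj u z,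
        Real.exp (y z - y u) * (g z - g u))) 0 := by
    unfold shPsi
    exact HasDerivAt.fun_sum fun u _ => (shF_deriv G y g S u).const_mul (w u)
  have hs := (hasDerivAt_iff_tendsto_slope.mp hd).mono_left
    (nhdsWithin_mono (0:ℝ) (fun t (ht : t ∈ Set.Ioi 0) => ne_of_gt ht))
  have hle := le_of_tendsto hs (b := ε * ‖g‖) (by
    filter_upwards [self_mem_nhdsWithin] with t ht
    have ht : 0 < t := ht
    have h1 := hy (y + t • g)
    have h2 : ‖y + t • g‖ ≤ ‖y‖ + t * ‖g‖ := by
      refine (norm_add_le _ _).trans ?_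
      rw [norm_smul, Real.norm_of_nonneg ht.le]
    rw [slope_def_field]
    simp only [zero_smul, add_zero, sub_zero]
    rw [div_le_iff₀ ht]
    nlinarith [mul_le_mul_of_nonneg_left h2 hε.le])
  have : ∑ u ∈ S, w u * (- shK (shD G y S u) * ∑ z ∈ S with G.Adj u z,
        Real.exp (y z - y u) * (g z - g u)) = - ∑ u ∈ S, w u * (shK (shD G y S u) *
        ∑ z ∈ S with G.Adj u z, Real.exp (y z - y u) * (g z - g u)) := by
    rw [← Finset.sum_neg_distrib]
    refine Finset.sum_congr rfl fun u _ => ?_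
    ring
  rw [this] at hle
  linarith

theorem sh_indep (hG : G.CliqueFree 3) (w : V → ℝ) (hw : ∀ v, 0 ≤ w v) (a : ℝ) :
    ∀ (S : Finset V) (b : ℝ), (∀ I ⊆ S, IsIndepFinset G I → b + ∑ v ∈ I, w v ≤ a) →
      ∀ y : V → ℝ, b + shPsi G w y S ≤ a := by
  intro S
  induction S using Finset.strongInduction with
  | H S ih =>
  intro b hI y0
  rcases S.eq_empty_or_nonempty with rfl | hne
  · have := hI ∅ (by simp) (by intro u hu; simp at hu)
    simpa [shPsi] using this
  by_contra hcon
  push Not at hcon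
  set δ := b + shPsi G w y0 S - a with hδ
  have hδ0 : 0 < δ := by linarith
  have hstep : ∀ y : V → ℝ, ∀ v ∈ S, b + w v + shPsi G w y (shDel G S v) ≤ a := by
    intro y v hv
    refine ih (shDel G S v) ?_ (b + w v) ?_ y
    · refine (Finset.filter_ssubset).mpr ⟨v, hv, by simp⟩
    · intro I hIs hind
      have hvI : v ∉ I := fun h => by
        have := hIs h
        simp [shDel] at this
      have := hI (insert v I) (Finset.insert_subset hv (hIs.trans (Finset.filter_subset _ _))) ?_
      · rw [Finset.sum_insert hvI] at this
        linarith
      · have hna : ∀ z ∈ I, ¬ G.Adj v z := fun z hz =>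
          (Finset.mem_filter.mp (hIs hz)).2.2
        intro s hs t ht
        rcases Finset.mem_insert.mp hs with rfl | hs1
        · rcases Finset.mem_insert.mp ht with rfl | ht
          · exact G.irrefl
          · exact hna t ht
        · rcases Finset.mem_insert.mp ht with rfl | ht
          · exact fun h => hna s hs1 h.symm
          · exact hind s hs1 t ht
  set ε := δ / (2 * (1 + ‖y0‖)) with hε
  have hn0 := norm_nonneg y0
  have hε0 : 0 < ε := by rw [hε]; positivity
  have hεδ : ε * (1 + ‖y0‖) < δ := by
    have : ε * (1 + ‖y0‖) = δ / 2 := by rw [hε]; field_simp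
    linarith
  obtain ⟨y, hy⟩ := sh_max G w hw S hε0
  set X := ∑ v ∈ S, Real.exp (y v) with hX
  have hX0 : 0 < X := Finset.sum_pos (fun _ _ => Real.exp_pos _) hne
  have hg : ‖shg G y S‖ ≤ X := by
    rw [pi_norm_le_iff_of_nonneg hX0.le]
    intro u
    have h0 : 0 ≤ shg G y S u := Finset.sum_nonneg fun _ _ => (Real.exp_pos _).le
    rw [Real.norm_of_nonneg h0]
    exact Finset.sum_le_sum_of_subset_of_nonneg (Finset.filter_subset _ _)
      fun _ _ _ => (Real.exp_pos _).le
  have h1 := (sh_dir G w S hε0 hy (shg G y S)).trans (sh_total G hG w hw y S)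
  have h2 : ∑ v ∈ S, Real.exp (y v) * (w v + shPsi G w y (shDel G S v) - shPsi G w y S)
      ≤ X * (ε * ‖y0‖ - δ) := by
    rw [hX, Finset.sum_mul]
    refine Finset.sum_le_sum fun v hv => mul_le_mul_of_nonneg_left ?_ (Real.exp_pos _).le
    have h3 := hstep y v hv
    have h4 := hy y0
    have h5 := mul_nonneg hε0.le (norm_nonneg y)
    linarith
  have h3 := mul_le_mul_of_nonneg_left hg hε0.le
  nlinarith

end graph

/-- every finite triangle-free graph has a probability distribution
on its independent sets covering each vertex `v` with probability at least `f(d_G(v))`. -/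
theorem local_shearer {V : Type*} [Fintype V] [DecidableEq V]
    (G : SimpleGraph V) [DecidableRel G.Adj] (hG : G.CliqueFree 3) :
    ∃ p : Finset V → ℝ,
      (∀ I, 0 ≤ p I) ∧
      (∀ I, p I ≠ 0 → IsIndepFinset G I) ∧
      (∑ I : Finset V, p I) = 1 ∧
      ∀ v : V,
        shearerF (G.degree v) ≤
          ∑ I ∈ Finset.univ.filter (fun I : Finset V => v ∈ I), p I := by
  classical
  let L : (Finset V → ℝ) →ₗ[ℝ] (V → ℝ) :=
    { toFun := fun p v => ∑ I ∈ Finset.univ.filter (fun I : Finset V => v ∈ I), p I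
      map_add' := by intro p q; ext v; simp [Finset.sum_add_distrib]
      map_smul' := by intro c p; ext v; simp [Finset.mul_sum] }
  let P : Set (Finset V → ℝ) :=
    stdSimplex ℝ (Finset V) ∩ {p | ∀ I, ¬ IsIndepFinset G I → p I = 0}
  have hPc : IsCompact P := by
    refine (isCompact_stdSimplex ℝ (Finset V)).inter_right ?_
    have : {p : Finset V → ℝ | ∀ I, ¬ IsIndepFinset G I → p I = 0}
        = ⋂ (I : Finset V) (_ : ¬ IsIndepFinset G I), {p | p I = 0} := by
      ext p; simp
    rw [this]
    exact isClosed_iInter fun I => isClosed_iInter fun _ =>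
      isClosed_eq (continuous_apply I) continuous_const
  have hPv : Convex ℝ P := by
    refine (convex_stdSimplex ℝ (Finset V)).inter ?_
    intro p hp q hq c d _ _ _ I hI
    simp [hp I hI, hq I hI]
  let target : V → ℝ := fun v => shearerF (G.degree v)
  have hLc : Continuous L := LinearMap.continuous_of_finiteDimensional L
  by_cases hdis : Disjoint (L '' P) (Set.Ici target)
  · exfalso
    obtain ⟨φ, s, t, h1, hst, h2⟩ := geometric_hahn_banach_compact_closed
      (hPv.linear_image L) (hPc.image hLc) (convex_Ici target) isClosed_Ici hdis
    let w : V → ℝ := fun v => φ (Pi.single v 1)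
    have hφ : ∀ x : V → ℝ, φ x = ∑ v, w v * x v := by
      intro x
      conv_lhs => rw [← Finset.univ_sum_single x]
      rw [map_sum]
      refine Finset.sum_congr rfl fun v _ => ?_
      have : (Pi.single v (x v) : V → ℝ) = x v • Pi.single v 1 := by
        rw [← Pi.single_smul]; simp
      rw [this, map_smul, smul_eq_mul, mul_comm]
    have hw : ∀ v, 0 ≤ w v := by
      intro v
      by_contra hneg
      push Not at hneg
      have ht0 := h2 target (Set.mem_Ici.mpr le_rfl)
      have hc : 0 ≤ (φ target - t) / (- w v) := div_nonneg (by linarith) (by linarith)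
      have hmem : target + ((φ target - t) / (- w v)) • (Pi.single v 1 : V → ℝ)
          ∈ Set.Ici target := by
        rw [Set.mem_Ici]
        apply le_add_of_nonneg_right
        apply smul_nonneg hc
        rw [Pi.single_nonneg]
        exact zero_le_one
      have := h2 _ hmem
      rw [map_add, map_smul, smul_eq_mul] at this
      change t < φ target + (φ target - t) / (- w v) * w v at this
      have hne : w v ≠ 0 := hneg.ne
      have e : (φ target - t) / (- w v) * w v = -(φ target - t) := by
        field_simp
      rw [e] at this
      linarith
    have hind : ∀ I ⊆ (Finset.univ : Finset V), IsIndepFinset G I → 0 + ∑ v ∈ I, w v ≤ s := by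
      intro I _ hI
      have hmem : (Pi.single I 1 : Finset V → ℝ) ∈ P := by
        refine ⟨single_mem_stdSimplex ℝ I, ?_⟩
        intro J hJ
        have : J ≠ I := by rintro rfl; exact hJ hI
        simp [this]
      have := h1 _ (Set.mem_image_of_mem L hmem)
      rw [hφ] at this
      have e : ∀ v, L (Pi.single I 1) v = if v ∈ I then 1 else 0 := by
        intro v
        change ∑ J ∈ Finset.univ.filter (fun J : Finset V => v ∈ J),
          (Pi.single I 1 : Finset V → ℝ) J = _
        simp [Pi.single_apply]
      simp only [e] at this
      simp at this
      linarith
    have hfin := sh_indep G hG w hw s Finset.univ 0 hind 0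
    have htar := h2 target (Set.mem_Ici.mpr le_rfl)
    rw [hφ] at htar
    have : shPsi G w 0 Finset.univ = ∑ v, w v * target v := by
      unfold shPsi shD
      refine Finset.sum_congr rfl fun v _ => ?_
      simp [target, ← SimpleGraph.card_neighborFinset_eq_degree,
        SimpleGraph.neighborFinset_eq_filter]
    linarith
  · obtain ⟨x, ⟨p, hp, rfl⟩, hx⟩ := Set.not_disjoint_iff.mp hdis
    refine ⟨p, hp.1.1, ?_, hp.1.2, fun v => hx v⟩
    intro I hI
    by_contra h
    exact hI (hp.2 I h)
end

section
/- For every δ > 0 there exists a natural number m₀ such that every finite triangle-free simple graph G with m ≥ m₀ edges admits a probability distribution p on its independent sets under which every vertex of G is covered with probability at least (1/(18^{1/3} + δ))·(ln m)^{2/3}/m^{1/3}; equivalently, the fractional chromatic number of every triangle-free graph with m edges is at most (18^{1/3} + o(1))·m^{1/3}/(ln m)^{2/3} as m → ∞. -/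
open Finset

open scoped Topology

/-- LP duality. -/
lemma exists_distribution {V : Type} [Fintype V] [DecidableEq V] (G : SimpleGraph V) (β : ℝ)
    (H : ∀ w : V → ℝ, (∀ v, 0 ≤ w v) → ∑ v, w v = 1 →
      ∃ I : Finset V, IsIndepFinset G I ∧ β ≤ ∑ v ∈ I, w v) :
    ∃ p : Finset V → ℝ,
        (∀ I, 0 ≤ p I) ∧
        (∀ I, p I ≠ 0 → IsIndepFinset G I) ∧
        (∑ I : Finset V, p I) = 1 ∧
        ∀ v : V, β ≤ ∑ I ∈ Finset.univ.filter (fun I : Finset V => v ∈ I), p I := by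
  classical
  let P : Set (Finset V → ℝ) :=
    stdSimplex ℝ (Finset V) ∩ {p | ∀ I, ¬ IsIndepFinset G I → p I = 0}
  let F : (Finset V → ℝ) →ₗ[ℝ] (V → ℝ) :=
    { toFun := fun p v => ∑ I ∈ Finset.univ.filter (fun I : Finset V => v ∈ I), p I
      map_add' := by intro p q; ext v; simp [Finset.sum_add_distrib]
      map_smul' := by intro c p; ext v; simp [Finset.mul_sum] }
  have hFdef : ∀ p v, F p v = ∑ I ∈ Finset.univ.filter (fun I : Finset V => v ∈ I), p I :=
    fun p v => rfl
  have hPc : IsCompact P := by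
    apply (isCompact_stdSimplex ℝ (Finset V)).inter_right
    have : {p : Finset V → ℝ | ∀ I, ¬ IsIndepFinset G I → p I = 0} =
        ⋂ I, ⋂ (_ : ¬ IsIndepFinset G I), {p | p I = 0} := by
      ext p; simp
    rw [this]
    exact isClosed_iInter fun I => isClosed_iInter fun _ =>
      isClosed_eq (continuous_apply I) continuous_const
  have hPconv : Convex ℝ P := by
    apply (convex_stdSimplex ℝ (Finset V)).inter
    intro p hp q hq s t _ _ _ I hI
    simp [hp I hI, hq I hI]
  let T : Set (V → ℝ) := {x | ∀ v, β ≤ x v}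
  have hTconv : Convex ℝ T := by
    intro x hx y hy s t hs ht hst v
    have h1 := hx v
    have h2 := hy v
    simp only [Pi.add_apply, Pi.smul_apply, smul_eq_mul]
    have : β = s * β + t * β := by rw [← add_mul, hst, one_mul]
    rw [this]
    gcongr
  have hTcl : IsClosed T := by
    have : T = ⋂ v, {x : V → ℝ | β ≤ x v} := by ext x; simp [T]
    rw [this]
    exact isClosed_iInter fun v => isClosed_le continuous_const (continuous_apply v)
  have hFcont : Continuous F := LinearMap.continuous_of_finiteDimensional F
  by_cases hd : Disjoint (F '' P) T
  · exfalso
    obtain ⟨f, u, v, hu, huv, hv⟩ := geometric_hahn_banach_compact_closed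
      (hPconv.linear_image F) (hPc.image hFcont) hTconv hTcl hd
    have hf : ∀ x : V → ℝ, f x = ∑ i, x i * f (Pi.single i 1) := by
      intro x
      conv_lhs => rw [pi_eq_sum_univ' x]
      simp [map_sum]
    set w : V → ℝ := fun i => f (Pi.single i 1) with hw
    have hw0 : ∀ i, 0 ≤ w i := by
      intro i
      by_contra hneg
      push Not at hneg
      have h0 := hv (fun _ => β) (fun _ => le_rfl)
      set t : ℝ := (f (fun _ => β) - v) / (- w i) with ht
      have htp : 0 ≤ t := div_nonneg (by linarith) (by linarith)
      have h1 := hv ((fun _ => β) + t • Pi.single i 1) (by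
        intro j
        simp only [Pi.add_apply, Pi.smul_apply, smul_eq_mul]
        have : 0 ≤ t * (Pi.single i (1:ℝ) : V → ℝ) j := by
          apply mul_nonneg htp
          by_cases hij : j = i
          · subst hij; simp
          · simp [hij]
        linarith)
      rw [map_add, map_smul, smul_eq_mul] at h1
      have h2 : t * w i = -(f (fun _ => β) - v) := by
        have hne : w i ≠ 0 := hneg.ne
        rw [ht, div_neg, neg_mul, div_mul_cancel₀ _ hne]
      change v < f (fun _ => β) + t * w i at h1
      rw [h2] at h1
      linarith
    have hind : ∀ I : Finset V, IsIndepFinset G I → ∑ i ∈ I, w i < u := by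
      intro I hI
      have hm : F (Pi.single I 1) ∈ F '' P := by
        refine ⟨_, ⟨single_mem_stdSimplex ℝ I, ?_⟩, rfl⟩
        intro J hJ
        have : J ≠ I := by rintro rfl; exact hJ hI
        simp [this]
      have := hu _ hm
      rw [hf] at this
      convert this using 1
      have e1 : ∀ i, F (Pi.single I 1) i = if i ∈ I then 1 else 0 := by
        intro i
        rw [hFdef]
        simp [Pi.single_apply]
      simp [e1, hw]
    have hsum : v < β * ∑ i, w i := by
      have := hv (fun _ => β) (fun _ => le_rfl)
      rw [hf, ← Finset.mul_sum] at this
      exact this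
    have hu0 : 0 < u := by
      have := hind ∅ (by intro u hu; simp at hu)
      simpa using this
    have hne : ∑ i, w i ≠ 0 := by
      intro h
      rw [h] at hsum
      linarith
    have hpos : 0 < ∑ i, w i := lt_of_le_of_ne (Finset.sum_nonneg fun i _ => hw0 i) hne.symm
    obtain ⟨I, hI, hb⟩ := H (fun i => w i / ∑ i, w i) (fun i => div_nonneg (hw0 i) hpos.le)
      (by rw [← Finset.sum_div]; exact div_self hne)
    rw [← Finset.sum_div, le_div_iff₀ hpos] at hb
    have := hind I hI
    linarith
  · rw [Set.not_disjoint_iff] at hd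
    obtain ⟨x, ⟨p, ⟨hp1, hp2⟩, rfl⟩, hx⟩ := hd
    refine ⟨p, hp1.1, ?_, hp1.2, fun v => hx v⟩
    intro I hI
    by_contra h
    exact hI (hp2 I h)
section core
set_option linter.unusedSectionVars false
variable {V : Type} [Fintype V] [DecidableEq V] (G : SimpleGraph V) [DecidableRel G.Adj]

/-- Neighbourhood sum of `p`. -/
def nbS (p : V → ℝ) (v : V) : ℝ := ∑ x, (if G.Adj v x then 1 else 0) * p x

/-- The potential function. -/
noncomputable def pot (a b : ℝ) (w p : V → ℝ) : ℝ :=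
  ∑ v, a * w v * Real.negMulLog (p v) / (nbS G p v + b)

lemma nbS_nonneg {p : V → ℝ} (hp : ∀ v, 0 ≤ p v) (v : V) : 0 ≤ nbS G p v :=
  Finset.sum_nonneg fun x _ => mul_nonneg (by split_ifs <;> norm_num) (hp x)

lemma nbS_update (p : V → ℝ) (x : V) (t : ℝ) (v : V) :
    nbS G (Function.update p x t) v = nbS G p v + (if G.Adj v x then 1 else 0) * (t - p x) := by
  unfold nbS
  have : ∀ y, (if G.Adj v y then (1:ℝ) else 0) * Function.update p x t y =
      (if G.Adj v y then (1:ℝ) else 0) * p y +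
      if y = x then (if G.Adj v x then (1:ℝ) else 0) * (t - p x) else 0 := by
    intro y
    by_cases h : y = x
    · subst h
      simp only [Function.update_self, if_true]
      ring
    · simp [h]
  rw [Finset.sum_congr rfl fun y _ => this y, Finset.sum_add_distrib]
  simp

lemma pot_hasDerivAt {a b : ℝ} (hb : 0 < b) (w p : V → ℝ) (hp : ∀ v, 0 ≤ p v) (x : V)
    (hx : 0 < p x) :
    HasDerivAt (fun t => pot G a b w (Function.update p x t))
      (a * w x * (-Real.log (p x) - 1) / (nbS G p x + b) -
        ∑ u, (if G.Adj x u then 1 else 0) *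
          (a * w u * Real.negMulLog (p u) / (nbS G p u + b) ^ 2)) (p x) := by
  have key : ∀ u, HasDerivAt (fun t => a * w u * Real.negMulLog (Function.update p x t u) /
      (nbS G (Function.update p x t) u + b))
      ((if u = x then a * w x * (-Real.log (p x) - 1) / (nbS G p x + b) else 0) -
        (if G.Adj x u then 1 else 0) *
          (a * w u * Real.negMulLog (p u) / (nbS G p u + b) ^ 2)) (p x) := by
    intro u
    have hS := nbS_nonneg G hp u
    by_cases hux : u = x
    · subst hux
      simp only [nbS_update, Function.update_self, SimpleGraph.irrefl, if_false, if_true, zero_mul,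
        add_zero, sub_zero]
      exact ((Real.hasDerivAt_negMulLog hx.ne').const_mul (a * w u)).div_const _
    · simp only [nbS_update, Function.update_of_ne hux, hux, if_false, zero_sub]
      by_cases hA : G.Adj x u
      · simp only [hA, hA.symm, if_true, one_mul]
        have h1 : HasDerivAt (fun t : ℝ => nbS G p u + (t - p x) + b) 1 (p x) := by
          have := (((hasDerivAt_id (p x)).sub_const (p x)).const_add (nbS G p u)).add_const b
          simpa using this
        have h2 := (hasDerivAt_const (p x) (a * w u * Real.negMulLog (p u))).div h1
          (by intro h; linarith)
        refine h2.congr_deriv ?_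
        rw [sub_self, add_zero]
        ring
      · have hA' : ¬ G.Adj u x := fun h => hA h.symm
        simp only [hA, hA', if_false, zero_mul, add_zero, neg_zero]
        exact hasDerivAt_const _ _
  have := HasDerivAt.fun_sum (u := Finset.univ) (fun u _ => key u)
  unfold pot
  rw [Finset.sum_sub_distrib] at this
  simpa using this

lemma pot_continuousOn {a b : ℝ} (hb : 0 < b) (w : V → ℝ) :
    ContinuousOn (fun p => pot G a b w p) {p | ∀ v, 0 ≤ p v} := by
  unfold pot
  apply continuousOn_finsetSum
  intro v _
  apply ContinuousOn.div
  · apply ContinuousOn.mul continuousOn_const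
    exact (Real.continuous_negMulLog.comp (continuous_apply v)).continuousOn
  · unfold nbS
    fun_prop
  · intro p hp
    have := nbS_nonneg G hp v
    positivity

theorem core (hG : G.CliqueFree 3) {a b : ℝ} (ha : 0 < a) (ha1 : a < 1) (hb : 2 / (1 - a) ≤ b)
    (w : V → ℝ) (hw : ∀ v, 0 ≤ w v) : ∀ (n : ℕ) (A : Finset V), A.card ≤ n →
    ∀ p : V → ℝ, (∀ v, 0 ≤ p v) → (∀ v, p v ≤ 1) → (∀ v, v ∉ A → p v = 0) →
    ∃ I : Finset V, I ⊆ A ∧ IsIndepFinset G I ∧ pot G a b w p ≤ ∑ v ∈ I, w v := by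
  have h1a : 0 < 1 - a := by linarith
  have hb0 : 0 < b := lt_of_lt_of_le (by positivity) hb
  intro n
  induction n with
  | zero =>
    intro A hA p _ _ hp
    have : A = ∅ := by simpa using hA
    subst this
    refine ⟨∅, by simp, by intro u hu; simp at hu, ?_⟩
    simp at hp
    simp [pot, hp]
  | succ n ih =>
    intro A hA p₀ h0 h1 hs
    let K : Set (V → ℝ) := {p | (∀ v, 0 ≤ p v) ∧ (∀ v, p v ≤ 1) ∧ (∀ v, v ∉ A → p v = 0)}
    have hK : IsCompact K := by
      have : K = Set.pi Set.univ (fun v => if v ∈ A then Set.Icc (0:ℝ) 1 else {0}) := by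
        ext p
        simp only [K, Set.mem_ofPred_eq, Set.mem_pi, Set.mem_univ, true_imp_iff]
        constructor
        · rintro ⟨h0, h1, h2⟩ v
          by_cases hv : v ∈ A
          · simp [hv, h0 v, h1 v]
          · simp [hv, h2 v hv]
        · intro h
          refine ⟨fun v => ?_, fun v => ?_, fun v hv => ?_⟩ <;> have := h v
          · by_cases hv : v ∈ A
            · simp [hv] at this; exact this.1
            · simp [hv] at this; exact this.ge
          · by_cases hv : v ∈ A
            · simp [hv] at this; exact this.2
            · simp [hv] at this; rw [this]; norm_num
          · simpa [hv] using this
      rw [this]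
      apply isCompact_univ_pi
      intro v
      split_ifs
      · exact isCompact_Icc
      · exact isCompact_singleton
    obtain ⟨p, hpK, hmax⟩ := hK.exists_isMaxOn ⟨p₀, h0, h1, hs⟩
      ((pot_continuousOn G (a := a) hb0 w).mono (fun p hp => hp.1))
    have hle : pot G a b w p₀ ≤ pot G a b w p := hmax ⟨h0, h1, hs⟩
    suffices ∃ I : Finset V, I ⊆ A ∧ IsIndepFinset G I ∧ pot G a b w p ≤ ∑ v ∈ I, w v by
      obtain ⟨I, h1, h2, h3⟩ := this
      exact ⟨I, h1, h2, hle.trans h3⟩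
    obtain ⟨hp0, hp1, hpA⟩ := hpK
    have hS0 := nbS_nonneg G hp0
    have hSb : ∀ v, 0 < nbS G p v + b := fun v => by linarith [hS0 v]
    have hq0 : ∀ v, 0 ≤ Real.negMulLog (p v) := fun v => Real.negMulLog_nonneg (hp0 v) (hp1 v)
    have hq1 : ∀ v, Real.negMulLog (p v) ≤ 1 := by
      intro v
      rcases (hp0 v).eq_or_lt with h | h
      · rw [← h]; simp
      · have := Real.one_sub_inv_le_log_of_pos h
        have h2 := mul_le_mul_of_nonneg_left this h.le
        rw [Real.negMulLog]
        rw [mul_sub, mul_inv_cancel₀ h.ne'] at h2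
        nlinarith
    set S := nbS G p with hS
    set R : V → ℝ := fun v => a * w v * Real.negMulLog (p v) / (S v + b) with hR
    set Q : V → ℝ := fun v => a * w v * Real.negMulLog (p v) / (S v + b) ^ 2 with hQ
    have hQ0 : ∀ v, 0 ≤ Q v := fun v =>
      div_nonneg (mul_nonneg (mul_nonneg ha.le (hw v)) (hq0 v)) (by positivity)
    set e : V → V → ℝ := fun u v => if G.Adj u v then 1 else 0 with he
    have he0 : ∀ u v, 0 ≤ e u v := fun u v => by simp only [he]; split_ifs <;> norm_num
    have hesymm : ∀ u v, e u v = e v u := fun u v => by simp only [he, G.adj_comm]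
    -- stationarity
    have hstat : ∀ x, R x - a * w x * p x / (S x + b) ≤ p x * ∑ u, e x u * Q u := by
      intro x
      have hsum0 : 0 ≤ ∑ u, e x u * Q u :=
        Finset.sum_nonneg fun u _ => mul_nonneg (he0 x u) (hQ0 u)
      rcases (hp0 x).eq_or_lt with h | h
      · simp [hR, ← h]
      rcases (hp1 x).eq_or_lt with h' | h'
      · have : R x = 0 := by simp [hR, h']
        rw [this]
        have h3 : 0 ≤ a * w x * p x / (S x + b) :=
          div_nonneg (mul_nonneg (mul_nonneg ha.le (hw x)) (hp0 x)) (hSb x).le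
        have h4 := mul_nonneg (hp0 x) hsum0
        linarith
      · have hd := pot_hasDerivAt G (a := a) hb0 w p hp0 x h
        have hlm : IsLocalMax (fun t => pot G a b w (Function.update p x t)) (p x) := by
          have : ∀ᶠ t in 𝓝 (p x), t ∈ Set.Ioo (0:ℝ) 1 := Ioo_mem_nhds h h'
          filter_upwards [this] with t ht
          rw [Function.update_eq_self]
          apply hmax
          have hxA : x ∈ A := by
            by_contra hx
            exact h.ne' (hpA x hx)
          refine ⟨fun v => ?_, fun v => ?_, fun v hv => ?_⟩
          · by_cases hv : v = x
            · subst hv; simp [ht.1.le]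
            · simp [hv, hp0 v]
          · by_cases hv : v = x
            · subst hv; simp [ht.2.le]
            · simp [hv, hp1 v]
          · have : v ≠ x := by rintro rfl; exact hv hxA
            simp [this, hpA v hv]
        have h0 := hlm.hasDerivAt_eq_zero hd
        have h2 : ∑ u, e x u * Q u = a * w x * (-Real.log (p x) - 1) / (S x + b) := by
          simp only [he, hQ, hS]
          linarith
        rw [h2]
        simp only [hR, Real.negMulLog]
        apply le_of_eq
        ring
    by_cases hz : ∀ v, p v = 0
    · refine ⟨∅, by simp, by intro u hu; simp at hu, ?_⟩
      simp [pot, hz]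
    push Not at hz
    obtain ⟨v₀, hv₀⟩ := hz
    have hv₀' : 0 < p v₀ := lt_of_le_of_ne (hp0 v₀) hv₀.symm
    -- choice of v
    have hex : ∃ v, 0 < p v ∧ 0 ≤ w v - R v - S v * Q v -
        ∑ x, e v x * (a * w x * p x / (S x + b)) := by
      by_contra hno
      push Not at hno
      have hlt : ∑ v, p v * (w v - R v - S v * Q v -
          ∑ x, e v x * (a * w x * p x / (S x + b))) < 0 := by
        apply Finset.sum_neg' 
        · intro v _
          rcases (hp0 v).eq_or_lt with h | h
          · simp [← h]
          · exact (mul_neg_of_pos_of_neg h (hno v h)).le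
        · exact ⟨v₀, Finset.mem_univ _, mul_neg_of_pos_of_neg hv₀' (hno v₀ hv₀')⟩
      have hA1 : ∀ v, a * (w v) ≤ w v - R v - S v * Q v := by
        intro v
        have hSv := hS0 v
        have hb1 : 2 ≤ b * (1 - a) := by
          rwa [div_le_iff₀ h1a] at hb
        have haw : 0 ≤ a * w v := mul_nonneg ha.le (hw v)
        have e1 : R v ≤ a * w v / b := by
          simp only [hR]
          apply div_le_div₀ haw _ hb0 (by linarith)
          exact mul_le_of_le_one_right haw (hq1 v)
        have e2 : S v * Q v ≤ R v := by
          simp only [hR, hQ]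
          rw [mul_div_assoc', div_le_div_iff₀ (by have := hSb v; positivity) (hSb v)]
          have hn : 0 ≤ a * w v * Real.negMulLog (p v) := mul_nonneg haw (hq0 v)
          have := hSb v
          nlinarith [mul_nonneg hn (mul_nonneg hb0.le this.le)]
        have e3 : a * w v / b ≤ (1 - a) * w v / 2 := by
          rw [div_le_div_iff₀ hb0 (by norm_num)]
          nlinarith [hw v, mul_nonneg (hw v) h1a.le, mul_le_mul_of_nonneg_left hb1 (hw v)]
        linarith
      have hA2 : ∑ v, p v * ∑ x, e v x * (a * w x * p x / (S x + b)) ≤ ∑ v, p v * (a * w v) := by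
        have : ∑ v, p v * ∑ x, e v x * (a * w x * p x / (S x + b)) =
            ∑ x, S x * (a * w x * p x / (S x + b)) := by
          simp only [Finset.mul_sum]
          rw [Finset.sum_comm]
          apply Finset.sum_congr rfl
          intro x _
          simp only [hS, nbS, Finset.sum_mul]
          apply Finset.sum_congr rfl
          intro v _
          rw [hesymm v x]
          ring
        rw [this]
        apply Finset.sum_le_sum
        intro x _
        rw [mul_div_assoc', div_le_iff₀ (hSb x)]
        have := mul_nonneg (mul_nonneg (mul_nonneg ha.le (hw x)) (hp0 x)) hb0.le
        nlinarith
      have hA3 : ∑ v, p v * (a * w v) ≤ ∑ v, p v * (w v - R v - S v * Q v) :=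
        Finset.sum_le_sum fun v _ => mul_le_mul_of_nonneg_left (hA1 v) (hp0 v)
      simp only [mul_sub, Finset.sum_sub_distrib] at hlt hA3
      linarith
    obtain ⟨v, hpv, hv⟩ := hex
    have hvA : v ∈ A := by
      by_contra hx
      exact hpv.ne' (hpA v hx)
    set A' := A.filter (fun u => u ≠ v ∧ ¬ G.Adj v u) with hA'
    set p' : V → ℝ := fun u => if u = v ∨ G.Adj v u then 0 else p u with hp'
    have hcard : A'.card ≤ n := by
      have : A' ⊂ A := by
        rw [Finset.ssubset_iff_of_subset (Finset.filter_subset _ _)]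
        exact ⟨v, hvA, by simp [hA']⟩
      have := Finset.card_lt_card this
      omega
    obtain ⟨I, hIA, hI, hIw⟩ := ih A' hcard p'
      (fun u => by simp only [hp']; split_ifs; exacts [le_rfl, hp0 u])
      (fun u => by simp only [hp']; split_ifs; exacts [zero_le_one, hp1 u])
      (fun u hu => by
        simp only [hp']
        split_ifs with h
        · rfl
        · apply hpA
          intro huA
          apply hu
          simp only [hA', Finset.mem_filter]
          push Not at h
          exact ⟨huA, h⟩)
    have hvI : v ∉ I := fun h => by
      have := hIA h
      simp [hA'] at this
    have hnI : ∀ u ∈ I, ¬ G.Adj v u := fun u hu => by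
      have := hIA hu
      simp only [hA', Finset.mem_filter] at this
      exact this.2.2
    refine ⟨insert v I, ?_, ?_, ?_⟩
    · intro u hu
      rcases Finset.mem_insert.1 hu with rfl | hu
      · exact hvA
      · exact Finset.filter_subset _ _ (hIA hu)
    · intro x hx y hy hxy
      rcases Finset.mem_insert.1 hx with rfl | hx2 <;> rcases Finset.mem_insert.1 hy with rfl | hy2
      · exact G.irrefl hxy
      · exact hnI y hy2 hxy
      · exact hnI x hx2 hxy.symm
      · exact hI x hx2 y hy2 hxy
    rw [Finset.sum_insert hvI]
    -- main estimate
    set c : V → ℝ := fun u => ∑ x, e v x * e x u * p x with hc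
    have hterm : ∀ u, R u + c u * Q u - e v u * R u - (if u = v then R v + S v * Q v else 0) ≤
        a * w u * Real.negMulLog (p' u) / (nbS G p' u + b) := by
      intro u
      by_cases huv : u = v
      · subst huv
        have h1 : p' u = 0 := by simp [hp']
        have h2 : c u = S u := by
          simp only [hc, hS, nbS]
          apply Finset.sum_congr rfl
          intro x _
          simp only [he]
          by_cases hx : G.Adj u x
          · simp [hx, hx.symm]
          · simp [hx]
        have h3 : e u u = 0 := by simp [he]
        rw [h1, h2, h3]
        simp
      · by_cases hA : G.Adj v u
        · have h1 : p' u = 0 := by simp [hp', hA]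
          have h2 : c u = 0 := by
            simp only [hc]
            apply Finset.sum_eq_zero
            intro x _
            by_cases h3 : G.Adj v x
            · by_cases h4 : G.Adj x u
              · exfalso
                exact hG {v, x, u} (SimpleGraph.is3Clique_triple_iff.2 ⟨h3, hA, h4⟩)
              · simp [he, h4]
            · simp [he, h3]
          have h3 : e v u = 1 := by simp [he, hA]
          rw [h1, h2, h3]
          simp [huv]
        · have h1 : p' u = p u := by simp [hp', hA, huv]
          have h3 : e v u = 0 := by simp [he, hA]
          have hS' : nbS G p' u = S u - c u := by
            simp only [hS, hc, nbS, ← Finset.sum_sub_distrib]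
            apply Finset.sum_congr rfl
            intro x _
            simp only [hp', he]
            by_cases hxv : x = v
            · subst hxv
              have : ¬ G.Adj u x := fun h => hA h.symm
              simp [this, hA]
            · by_cases hvx : G.Adj v x
              · by_cases hxu : G.Adj x u
                · simp [hvx, hxu, hxu.symm]
                · have : ¬ G.Adj u x := fun h => hxu h.symm
                  simp [hxu, this]
              · simp [hxv, hvx]
          have hnn : 0 ≤ nbS G p' u := nbS_nonneg G
            (fun u => by simp only [hp']; split_ifs; exacts [le_rfl, hp0 u]) u
          rw [h1, h3, hS']
          rw [hS'] at hnn
          simp only [huv, if_false, zero_mul, sub_zero, hR, hQ]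
          have hT := hSb u
          have hTc : 0 < S u - c u + b := by linarith
          have hn : 0 ≤ a * w u * Real.negMulLog (p u) :=
            mul_nonneg (mul_nonneg ha.le (hw u)) (hq0 u)
          have hkey : 1 / (S u + b) + c u / (S u + b) ^ 2 ≤ 1 / (S u - c u + b) := by
            rw [div_add_div _ _ hT.ne' (by positivity), div_le_div_iff₀ (by positivity) hTc]
            nlinarith [mul_nonneg hT.le (sq_nonneg (c u))]
          have := mul_le_mul_of_nonneg_left hkey hn
          calc _ = a * w u * Real.negMulLog (p u) * (1 / (S u + b) + c u / (S u + b) ^ 2) := by ring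
            _ ≤ _ := this
            _ = _ := by ring
    have hsum := Finset.sum_le_sum (fun u (_ : u ∈ Finset.univ) => hterm u)
    simp only [Finset.sum_sub_distrib, Finset.sum_add_distrib] at hsum
    rw [Finset.sum_ite_eq' Finset.univ v (fun _ => R v + S v * Q v)] at hsum
    have hcQ : ∑ u, e v u * R u - ∑ x, e v x * (a * w x * p x / (S x + b)) ≤ ∑ u, c u * Q u := by
      have : ∑ u, c u * Q u = ∑ x, e v x * (p x * ∑ u, e x u * Q u) := by
        simp only [hc, Finset.sum_mul, Finset.mul_sum]
        rw [Finset.sum_comm]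
        apply Finset.sum_congr rfl; intro x _
        apply Finset.sum_congr rfl; intro u _
        ring
      rw [this, ← Finset.sum_sub_distrib]
      apply Finset.sum_le_sum
      intro x _
      rw [← mul_sub]
      exact mul_le_mul_of_nonneg_left (hstat x) (he0 v x)
    have hP : pot G a b w p = ∑ u, R u := rfl
    have hP' : pot G a b w p' = ∑ u, a * w u * Real.negMulLog (p' u) / (nbS G p' u + b) := rfl
    simp only [Finset.mem_univ, if_true] at hsum
    linarith
end core

lemma amgm3 {x y z t : ℝ} (hx : 0 ≤ x) (hy : 0 ≤ y) (hz : 0 ≤ z)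
    (h : t ^ 3 ≤ x * y * z) : 3 * t ≤ x + y + z := by
  have h1 : (3 * t) ^ 3 ≤ (x + y + z) ^ 3 := by
    have h27 : 27 * (x * y * z) ≤ (x + y + z) ^ 3 := by
      nlinarith [mul_nonneg hx (sq_nonneg (y - z)), mul_nonneg hy (sq_nonneg (x - z)),
        mul_nonneg hz (sq_nonneg (x - y)), mul_nonneg hx (sq_nonneg (x - y)),
        mul_nonneg hx (sq_nonneg (x - z)), mul_nonneg hy (sq_nonneg (x - y)),
        mul_nonneg hy (sq_nonneg (y - z)), mul_nonneg hz (sq_nonneg (x - z)),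
        mul_nonneg hz (sq_nonneg (y - z))]
    nlinarith
  exact (Odd.strictMono_pow (by decide : Odd 3)).le_iff_le.1 h1

set_option maxHeartbeats 2000000 in
theorem finite_step {V : Type} [Fintype V] [DecidableEq V] (G : SimpleGraph V)
    [DecidableRel G.Adj] (hG : G.CliqueFree 3) (w : V → ℝ) (hw : ∀ v, 0 ≤ w v)
    (hw1 : ∑ v, w v = 1) {ε β b M l τ Q₁ Q₂ : ℝ} (hε : 0 < ε) (hε3 : 3 * ε < 1)
    (hβ : 0 < β) (hbdef : b = 2 / ε) (hM : 1 < M) (hl : l = 3 * Real.log M) (hτ : 0 < τ)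
    (hτM : M * τ ≤ 1) (hlog : (1 / 3 - ε) * l ≤ - Real.log (M * τ))
    (hm : 0 < G.edgeFinset.card)
    (H1 : b ≤ ε * (β * M))
    (H2 : b * M * (1 + 1 / ε) * (3 * β / ((1 - ε) * l)) ≤ ε)
    (hQ₁ : Q₁ = (1 + ε) * (3 * β / ((1 - ε) * l)))
    (hQ₂ : Q₂ = (1 + ε) * β ^ 2 * 3 / ((1 - ε) * (1 - 3 * ε) * l))
    (H3 : Q₂ ≤ ε * τ)
    (H4 : Q₁ * Q₂ * (2 * G.edgeFinset.card) ≤ (1 - 3 * ε) ^ 3)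
    (Hno : ∀ I : Finset V, IsIndepFinset G I → ∑ v ∈ I, w v < β) : False := by
  have ha : 0 < 1 - ε := by linarith
  have hb : 0 < b := by rw [hbdef]; positivity
  have hb' : 2 / (1 - (1 - ε)) ≤ b := by rw [hbdef]; simp
  have hM0 : 0 < M := by linarith
  have hlM : 0 < Real.log M := Real.log_pos hM
  have hl0 : 0 < l := by rw [hl]; positivity
  have h3 : 0 < 1 - 3 * ε := by linarith
  set d : V → ℝ := fun v => nbS G (fun _ => 1) v with hd
  have hd0 : ∀ v, 0 ≤ d v := nbS_nonneg G (fun _ => zero_le_one)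
  have hdsum : ∑ v, d v = 2 * (G.edgeFinset.card : ℝ) := by
    have h1 : ∀ v, d v = G.degree v := by
      intro v
      simp [hd, nbS, ← SimpleGraph.card_neighborFinset_eq_degree, SimpleGraph.neighborFinset_eq_filter]
    simp only [h1]
    exact_mod_cast G.sum_degrees_eq_twice_card_edges
  have hpot : ∀ p : V → ℝ, (∀ v, 0 ≤ p v) → (∀ v, p v ≤ 1) → pot G (1 - ε) b w p < β := by
    intro p h0 h1
    obtain ⟨I, _, hI, hle⟩ := core G hG ha (by linarith) hb' w hw _ Finset.univ le_rfl p h0 h1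
      (by simp)
    exact hle.trans_lt (Hno I hI)
  -- first choice
  set X : V → ℝ := fun v => w v / (d v + b * M) with hX
  have hX0 : ∀ v, 0 ≤ X v := fun v =>
    div_nonneg (hw v) (by have := hd0 v; positivity)
  have hXs : ∑ v, X v ≤ 3 * β / ((1 - ε) * l) := by
    have h := hpot (fun _ => 1 / M) (fun _ => by positivity)
      (fun _ => by rw [div_le_one hM0]; exact hM.le)
    have e1 : pot G (1 - ε) b w (fun _ => 1 / M) = (1 - ε) * l / 3 * ∑ v, X v := by
      rw [pot, Finset.mul_sum]
      apply Finset.sum_congr rfl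
      intro v _
      have e2 : nbS G (fun _ => 1 / M) v = d v / M := by
        simp only [hd, nbS, Finset.sum_div]
        apply Finset.sum_congr rfl
        intro x _
        ring
      have e3 : Real.negMulLog (1 / M) = l / (3 * M) := by
        rw [Real.negMulLog, one_div, Real.log_inv, hl]
        field_simp
      rw [e2, e3]
      simp only [hX]
      have : 0 < d v + b * M := by have := hd0 v; positivity
      have e4 : d v / M + b = (d v + b * M) / M := by field_simp
      rw [e4]
      field_simp
    rw [e1] at h
    rw [le_div_iff₀ (by positivity)]
    linarith
  -- second choice
  set Y : V → ℝ := fun v => w v * min (w v) τ with hY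
  have hmin0 : ∀ v, 0 ≤ min (w v) τ := fun v => le_min (hw v) hτ.le
  have hY0 : ∀ v, 0 ≤ Y v := fun v => mul_nonneg (hw v) (hmin0 v)
  have hYs : ∑ v, Y v ≤ Q₂ := by
    have hp1 : ∀ v, M * min (w v) τ ≤ M * τ := fun v =>
      mul_le_mul_of_nonneg_left (min_le_right _ _) hM0.le
    have hp0 : ∀ v, 0 ≤ M * min (w v) τ := fun v => mul_nonneg hM0.le (hmin0 v)
    have h := hpot (fun v => M * min (w v) τ) hp0 (fun v => (hp1 v).trans hτM)
    have hS : ∀ v, nbS G (fun v => M * min (w v) τ) v ≤ M * β := by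
      intro v
      have h1 : IsIndepFinset G (Finset.univ.filter (fun x => G.Adj v x)) := by
        intro x hx y hy hxy
        simp only [Finset.mem_filter, Finset.mem_univ, true_and] at hx hy
        exact hG {v, x, y} (SimpleGraph.is3Clique_triple_iff.2 ⟨hx, hy, hxy⟩)
      have h2 := Hno _ h1
      calc nbS G (fun v => M * min (w v) τ) v ≤
          M * ∑ x ∈ Finset.univ.filter (fun x => G.Adj v x), w x := by
            rw [nbS, Finset.sum_filter, Finset.mul_sum]
            apply Finset.sum_le_sum
            intro x _
            split_ifs
            · rw [one_mul]
              exact mul_le_mul_of_nonneg_left (min_le_left _ _) hM0.le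
            · simp
        _ ≤ M * β := mul_le_mul_of_nonneg_left h2.le hM0.le
    have e1 : (1 - ε) * M * ((1 / 3 - ε) * l) / (M * β + b) * ∑ v, Y v ≤
        pot G (1 - ε) b w (fun v => M * min (w v) τ) := by
      rw [pot, Finset.mul_sum]
      apply Finset.sum_le_sum
      intro v _
      have hS0 := nbS_nonneg G hp0 v
      have hq : M * min (w v) τ * ((1 / 3 - ε) * l) ≤ Real.negMulLog (M * min (w v) τ) := by
        rcases (hp0 v).eq_or_lt with h0 | h0
        · rw [← h0]; simp
        · rw [Real.negMulLog, neg_mul_comm]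
          apply mul_le_mul_of_nonneg_left _ (hp0 v)
          have := Real.log_le_log h0 (hp1 v)
          linarith
      calc (1 - ε) * M * ((1 / 3 - ε) * l) / (M * β + b) * Y v
          = (1 - ε) * w v * (M * min (w v) τ * ((1 / 3 - ε) * l)) / (M * β + b) := by
            simp only [hY]; ring
        _ ≤ (1 - ε) * w v * Real.negMulLog (M * min (w v) τ) / (M * β + b) := by
            apply div_le_div_of_nonneg_right _ (by positivity)
            exact mul_le_mul_of_nonneg_left hq (mul_nonneg ha.le (hw v))
        _ ≤ _ := by
            apply div_le_div_of_nonneg_left _ (by linarith) (by linarith [hS v])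
            apply mul_nonneg (mul_nonneg ha.le (hw v))
            exact Real.negMulLog_nonneg (hp0 v) ((hp1 v).trans hτM)
    have e2 := e1.trans h.le
    have e3 : (1 - ε) * M * ((1 / 3 - ε) * l) * ∑ v, Y v ≤ β * (M * β + b) := by
      rw [div_mul_eq_mul_div, div_le_iff₀ (by positivity)] at e2
      exact e2
    have e4 : β * (M * β + b) ≤ M * ((1 + ε) * β ^ 2) := by nlinarith
    rw [hQ₂, le_div_iff₀ (by positivity)]
    have e5 : M * ((1 - ε) * ((1 / 3 - ε) * l) * ∑ v, Y v) ≤ M * ((1 + ε) * β ^ 2) := by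
      linarith
    have e6 := le_of_mul_le_mul_left e5 hM0
    linarith
  have hQ₁0 : 0 < Q₁ := by rw [hQ₁]; positivity
  have hQ₂0 : 0 < Q₂ := by rw [hQ₂]; positivity
  set Q₃ : ℝ := 2 * G.edgeFinset.card with hQ₃
  have hQ₃0 : 0 < Q₃ := by
    have : (0:ℝ) < G.edgeFinset.card := by exact_mod_cast hm
    positivity
  set θ := 1 - 3 * ε with hθ
  set C := b * M * (1 + 1 / ε) with hC
  have hpt : ∀ v, w v ≤ C * X v + Y v / τ +
      θ / 3 * ((1 + ε) * X v / Q₁ + Y v / Q₂ + d v / Q₃) := by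
    intro v
    have hXv := hX0 v
    have hYv := hY0 v
    have hdv := hd0 v
    have hwv := hw v
    have n1 : 0 ≤ C * X v := by positivity
    have n2 : 0 ≤ Y v / τ := by positivity
    have n3 : 0 ≤ θ / 3 * ((1 + ε) * X v / Q₁ + Y v / Q₂ + d v / Q₃) := by positivity
    have hden : 0 < d v + b * M := by positivity
    by_cases hlow : d v < b * M / ε
    · have : w v ≤ C * X v := by
        simp only [hX]
        rw [mul_div_assoc', le_div_iff₀ hden, mul_comm]
        apply mul_le_mul_of_nonneg_right _ hwv
        have : C = b * M + b * M / ε := by rw [hC]; ring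
        linarith
      linarith
    by_cases hheavy : τ < w v
    · have : w v ≤ Y v / τ := by
        simp only [hY]
        rw [min_eq_right hheavy.le, mul_div_cancel_right₀ _ hτ.ne']
      linarith
    push Not at hlow hheavy
    have hd1 : b * M ≤ ε * d v := by
      rw [div_le_iff₀ hε] at hlow; linarith
    have hdpos : 0 < d v := by
      have : 0 < b * M := by positivity
      by_contra hcon
      nlinarith
    have hYe : Y v = w v ^ 2 := by
      simp only [hY]
      rw [min_eq_left hheavy]; ring
    have hXe : w v / d v ≤ (1 + ε) * X v := by
      simp only [hX]
      rw [mul_div_assoc', div_le_div_iff₀ hdpos hden]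
      nlinarith
    have key : 3 * (w v / θ) ≤ (1 + ε) * X v / Q₁ + Y v / Q₂ + d v / Q₃ := by
      apply amgm3 (by positivity) (by positivity) (by positivity)
      calc (w v / θ) ^ 3 = w v ^ 3 / θ ^ 3 := by rw [div_pow]
        _ ≤ w v ^ 3 / (Q₁ * Q₂ * Q₃) :=
            div_le_div_of_nonneg_left (by positivity) (by positivity) H4
        _ = (w v / d v) / Q₁ * (Y v / Q₂) * (d v / Q₃) := by
            rw [hYe]; field_simp
        _ ≤ _ := by gcongr
    have : w v ≤ θ / 3 * ((1 + ε) * X v / Q₁ + Y v / Q₂ + d v / Q₃) := by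
      have h5 := mul_le_mul_of_nonneg_left key (by positivity : 0 ≤ θ / 3)
      have h6 : θ / 3 * (3 * (w v / θ)) = w v := by field_simp
      linarith
    linarith
  have hsum := Finset.sum_le_sum (fun v (_ : v ∈ Finset.univ) => hpt v)
  simp only [Finset.sum_add_distrib, ← Finset.mul_sum, ← Finset.sum_div] at hsum
  rw [hw1, hdsum] at hsum
  have s1 : C * ∑ v, X v ≤ ε := (mul_le_mul_of_nonneg_left hXs (by positivity)).trans H2
  have s2 : (∑ v, Y v) / τ ≤ ε := by
    rw [div_le_iff₀ hτ]; exact hYs.trans H3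
  have s3 : (1 + ε) * (∑ v, X v) / Q₁ ≤ 1 := by
    rw [div_le_one hQ₁0, hQ₁]
    exact mul_le_mul_of_nonneg_left hXs (by positivity)
  have s4 : (∑ v, Y v) / Q₂ ≤ 1 := by rw [div_le_one hQ₂0]; exact hYs
  have s5 : Q₃ / Q₃ = 1 := div_self hQ₃0.ne'
  have s6 : θ / 3 * ((1 + ε) * (∑ v, X v) / Q₁ + (∑ v, Y v) / Q₂ + Q₃ / Q₃) ≤ θ / 3 * 3 :=
    mul_le_mul_of_nonneg_left (by linarith) (by positivity)
  linarith

lemma exists_eps {c : ℝ} (hc : 18 * c ^ 3 < 1) : ∃ ε : ℝ, 0 < ε ∧ 3 * ε < 1 ∧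
    18 * c ^ 3 * (1 + ε) ^ 2 < (1 - 3 * ε) ^ 4 * (1 - ε) ^ 2 := by
  have h1 : ∀ᶠ ε : ℝ in 𝓝 0, 18 * c ^ 3 * (1 + ε) ^ 2 < (1 - 3 * ε) ^ 4 * (1 - ε) ^ 2 := by
    apply ContinuousAt.eventually_lt (by fun_prop) (by fun_prop)
    simpa using hc
  have h2 : ∀ᶠ ε : ℝ in 𝓝 0, 3 * ε < 1 := by
    apply ContinuousAt.eventually_lt (by fun_prop) (by fun_prop)
    simp
  have h3 : ∀ᶠ ε : ℝ in 𝓝[>] 0, 0 < ε := self_mem_nhdsWithin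
  obtain ⟨ε, h⟩ := (h3.and ((h2.and h1).filter_mono nhdsWithin_le_nhds)).exists
  exact ⟨ε, h.1, h.2.1, h.2.2⟩

set_option maxHeartbeats 2000000 in
/-- for every `δ > 0` there is `m₀` such that every triangle-free graph
with `m ≥ m₀` edges has a probability distribution on its independent sets covering every
vertex with probability at least `(1/(18^{1/3} + δ))·(ln m)^{2/3}/m^{1/3}`; equivalently,
its fractional chromatic number is at most `(18^{1/3} + o(1))·m^{1/3}/(ln m)^{2/3}`. -/
theorem fracChromatic_of_triangle_free_edges (δ : ℝ) (hδ : 0 < δ) :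
    ∃ m₀ : ℕ, ∀ (V : Type) [Fintype V] [DecidableEq V] (G : SimpleGraph V)
      [DecidableRel G.Adj], G.CliqueFree 3 → m₀ ≤ G.edgeFinset.card →
      ∃ p : Finset V → ℝ,
        (∀ I, 0 ≤ p I) ∧
        (∀ I, p I ≠ 0 → IsIndepFinset G I) ∧
        (∑ I : Finset V, p I) = 1 ∧
        ∀ v : V,
          (1 / ((18 : ℝ) ^ ((1 : ℝ) / 3) + δ)) *
              Real.log (G.edgeFinset.card) ^ ((2 : ℝ) / 3) /
                (G.edgeFinset.card : ℝ) ^ ((1 : ℝ) / 3) ≤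
            ∑ I ∈ Finset.univ.filter (fun I : Finset V => v ∈ I), p I := by
  set r : ℝ := (18 : ℝ) ^ ((1 : ℝ) / 3) with hr
  have hr0 : 0 < r := by positivity
  have hr3 : r ^ 3 = 18 := by
    rw [hr, ← Real.rpow_natCast, ← Real.rpow_mul (by norm_num)]; norm_num
  set c : ℝ := 1 / (r + δ) with hc
  have hc0 : 0 < c := by positivity
  have hc3 : 18 * c ^ 3 < 1 := by
    rw [hc, div_pow, one_pow, mul_one_div, div_lt_one (by positivity), ← hr3]
    exact pow_lt_pow_left₀ (by linarith) hr0.le (by norm_num)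
  obtain ⟨ε, hε, hε3, hmain⟩ := exists_eps hc3
  have ha : 0 < 1 - ε := by linarith
  have h3 : 0 < 1 - 3 * ε := by linarith
  set b : ℝ := 2 / ε with hb
  have hb0 : 0 < b := by positivity
  set K₁ : ℝ := b / (ε * c) with hK₁
  set K₂ : ℝ := b * (1 + 1 / ε) * (3 * c / (1 - ε)) / ε with hK₂
  set K₃ : ℝ := (1 + ε) * c ^ 2 * 3 / ((1 - ε) * (1 - 3 * ε)) / ε with hK₃
  set Y₀ : ℝ := 1 + K₁ + K₂ + K₃ / ε with hY₀
  have hK₁0 : 0 < K₁ := by positivity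
  have hK₂0 : 0 < K₂ := by positivity
  have hK₃0 : 0 < K₃ := by positivity
  have hK₃1 : 0 < K₃ / ε := by positivity
  refine ⟨⌈Real.exp (Y₀ ^ 3)⌉₊, ?_⟩
  intro V _ _ G _ hG hm
  have hm1 : Real.exp (Y₀ ^ 3) ≤ G.edgeFinset.card := (Nat.le_ceil _).trans (by exact_mod_cast hm)
  set m : ℝ := (G.edgeFinset.card : ℝ) with hmdef
  have hm0 : 0 < m := (Real.exp_pos _).trans_le hm1
  have hlog1 : Y₀ ^ 3 ≤ Real.log m := (Real.le_log_iff_exp_le hm0).2 hm1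
  have hY₀1 : 1 ≤ Y₀ := by linarith
  set l := Real.log m with hl
  have hl0 : 0 < l := lt_of_lt_of_le (by positivity) hlog1
  set y : ℝ := l ^ ((1 : ℝ) / 3) with hy
  have hy3 : y ^ 3 = l := by
    rw [hy, ← Real.rpow_natCast, ← Real.rpow_mul hl0.le]; norm_num
  have hy2 : l ^ ((2 : ℝ) / 3) = y ^ 2 := by
    rw [hy, ← Real.rpow_natCast, ← Real.rpow_mul hl0.le]; norm_num
  have hy0 : 0 < y := by positivity
  have hyY : Y₀ ≤ y := by
    apply le_of_pow_le_pow_left₀ (n := 3) (by norm_num) hy0.le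
    rwa [hy3]
  set M : ℝ := m ^ ((1 : ℝ) / 3) with hM
  have hM0 : 0 < M := by positivity
  have hM3 : M ^ 3 = m := by
    rw [hM, ← Real.rpow_natCast, ← Real.rpow_mul hm0.le]; norm_num
  have hlogM : l = 3 * Real.log M := by
    rw [hM, Real.log_rpow hm0]; ring
  have hM1 : 1 < M := by
    have : 0 < Real.log M := by linarith
    exact (Real.log_pos_iff hM0.le).1 this
  rw [hy2]
  have hβ : 0 < c * y ^ 2 / M := by positivity
  apply exists_distribution
  intro w hw hw1
  by_contra hno
  push Not at hno
  set τ : ℝ := Real.exp (ε * y ^ 3) / M ^ 2 with hτ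
  have hlogτ : Real.log (M * τ) = (-1 / 3 + ε) * l := by
    rw [hτ, Real.log_mul hM0.ne' (by positivity), Real.log_div (by positivity) (by positivity),
      Real.log_exp, Real.log_pow, hy3]
    push_cast
    linarith
  have hτ0 : 0 < τ := by positivity
  refine finite_step G hG w hw hw1 (ε := ε) (β := c * y ^ 2 / M) (b := b) (M := M) (l := l)
    (τ := τ) hε hε3 hβ rfl hM1 hlogM hτ0 ?_ ?_ (Nat.cast_pos.1 hm0) ?_ ?_ rfl rfl ?_ ?_ hno
  · rw [← Real.log_nonpos_iff (by positivity), hlogτ]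
    exact mul_nonpos_of_nonpos_of_nonneg (by linarith) hl0.le
  · rw [hlogτ]; apply le_of_eq; ring
  · have h1 : K₁ ≤ y ^ 2 := by nlinarith
    rw [hK₁, div_le_iff₀ (by positivity)] at h1
    calc b ≤ y ^ 2 * (ε * c) := h1
      _ = _ := by field_simp
  · have h1 : K₂ ≤ y := by linarith
    rw [hK₂, div_le_iff₀ hε] at h1
    have e : b * M * (1 + 1 / ε) * (3 * (c * y ^ 2 / M) / ((1 - ε) * l)) =
        b * (1 + 1 / ε) * (3 * c / (1 - ε)) / y := by
      rw [← hy3]; field_simp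
    rw [e, div_le_iff₀ hy0]
    linarith
  · have h1 : K₃ / ε ≤ y ^ 2 := by nlinarith
    rw [div_le_iff₀ hε] at h1
    have h2 : K₃ * y ≤ Real.exp (ε * y ^ 3) := by
      have := Real.add_one_le_exp (ε * y ^ 3)
      nlinarith
    have e : (1 + ε) * (c * y ^ 2 / M) ^ 2 * 3 / ((1 - ε) * (1 - 3 * ε) * l) =
        ε * (K₃ * y / M ^ 2) := by
      rw [← hy3, hK₃]; field_simp
    rw [e, hτ]
    gcongr
  · have e : (1 + ε) * (3 * (c * y ^ 2 / M) / ((1 - ε) * l)) *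
        ((1 + ε) * (c * y ^ 2 / M) ^ 2 * 3 / ((1 - ε) * (1 - 3 * ε) * l)) * (2 * m) =
        18 * c ^ 3 * (1 + ε) ^ 2 / ((1 - ε) ^ 2 * (1 - 3 * ε)) := by
      rw [← hy3, ← hM3]; field_simp; ring
    rw [e, div_le_iff₀ (by positivity)]
    linarith
end
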